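/- arXiv:2503.11422 — 4 statements merged into one kernel-verified Lean document; each statement's English description precedes it below -/
import Mathlib

section
/- The triple nested sum over triples of distinct odd positive integers satisfies ∑_{p=2}^{∞} ∑_{m=1}^{p-1} ∑_{k=0}^{m-1} 1/((2k+1)²·(2m+1)²·(2p+1)²) = (1/6!)·(π/2)⁶, where k < m < p range over nonnegative integers. -/
open Real

/-- Newton's identity for the second elementary symmetric function, as an ordered double sum. -/
theorem two_mul_sum_range_sum_range_mul {R : Type*} [CommRing R] (a : ℕ → R) (N : ℕ) :
    2 * ∑ m ∈ Finset.range N, ∑ k ∈ Finset.range m, a k * a m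
      = (∑ i ∈ Finset.range N, a i) ^ 2 - ∑ i ∈ Finset.range N, a i ^ 2 := by
  induction N with
  | zero => simp
  | succ N ih =>
    simp only [Finset.sum_range_succ _ N, mul_add, ← Finset.sum_mul] at ih ⊢
    linear_combination ih

/-- Newton's identity for the third elementary symmetric function, as an ordered triple sum. -/
theorem six_mul_sum_range_sum_range_sum_range_mul {R : Type*} [CommRing R] (a : ℕ → R) (N : ℕ) :
    6 * ∑ p ∈ Finset.range N, ∑ m ∈ Finset.range p, ∑ k ∈ Finset.range m, a k * a m * a p
      = (∑ i ∈ Finset.range N, a i) ^ 3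
        - 3 * (∑ i ∈ Finset.range N, a i) * (∑ i ∈ Finset.range N, a i ^ 2)
        + 2 * ∑ i ∈ Finset.range N, a i ^ 3 := by
  induction N with
  | zero => simp
  | succ N ih =>
    have h := two_mul_sum_range_sum_range_mul a N
    simp only [Finset.sum_range_succ _ N, mul_add, ← Finset.sum_mul] at ih h ⊢
    linear_combination ih + 3 * a N * h

/-- The sum of `1 / n ^ s` over odd `n`, in terms of the sum over all `n`. -/
theorem HasSum.one_div_odd_pow {s : ℕ} {z : ℝ}
    (h : HasSum (fun n : ℕ => (1 : ℝ) / (n : ℝ) ^ s) z) :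
    HasSum (fun n : ℕ => (1 : ℝ) / (2 * (n : ℝ) + 1) ^ s) ((1 - 1 / 2 ^ s) * z) := by
  have he : HasSum (fun n : ℕ => (1 : ℝ) / ((2 * n : ℕ) : ℝ) ^ s) (1 / 2 ^ s * z) := by
    simpa only [Nat.cast_mul, Nat.cast_ofNat, mul_pow, one_div_mul_one_div]
      using h.mul_left ((1 : ℝ) / 2 ^ s)
  have ho : Summable (fun n : ℕ => (1 : ℝ) / ((2 * n + 1 : ℕ) : ℝ) ^ s) :=
    h.summable.comp_injective (i := fun n : ℕ => 2 * n + 1) fun a b hab => by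
      simpa using hab
  have hz := (HasSum.even_add_odd (f := fun n : ℕ => (1 : ℝ) / (n : ℝ) ^ s) he ho.hasSum).unique h
  have key := ho.hasSum
  rw [show (∑' n : ℕ, (1 : ℝ) / ((2 * n + 1 : ℕ) : ℝ) ^ s) = (1 - 1 / 2 ^ s) * z by
    linear_combination hz] at key
  simpa using key

theorem hasSum_zeta_six : HasSum (fun n : ℕ => (1 : ℝ) / (n : ℝ) ^ 6) (π ^ 6 / 945) := by
  have hb : bernoulli 6 = 1 / 42 := by
    rw [bernoulli_eq_bernoulli'_of_ne_one (by decide), bernoulli'_def]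
    norm_num [Finset.sum_range_succ, Nat.choose, bernoulli'_eq_zero_of_odd]
  convert hasSum_zeta_nat three_ne_zero using 1
  norm_num [hb, Nat.factorial]
  ring

theorem triple_nested_odd_reciprocal_squares_sum :
    (∑' p : ℕ, ∑ m ∈ Finset.range p, ∑ k ∈ Finset.range m,
      (1 : ℝ) / ((2 * (k : ℝ) + 1) ^ 2 * (2 * (m : ℝ) + 1) ^ 2 * (2 * (p : ℝ) + 1) ^ 2))
      = (1 / (Nat.factorial 6)) * (π / 2) ^ 6 := by
  have h1 := hasSum_zeta_two.one_div_odd_pow.tendsto_sum_nat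
  have h2 := hasSum_zeta_four.one_div_odd_pow.tendsto_sum_nat
  have h3 := hasSum_zeta_six.one_div_odd_pow.tendsto_sum_nat
  refine HasSum.tsum_eq ((hasSum_iff_tendsto_nat_of_nonneg (fun p => ?_) _).2 ?_)
  · positivity
  have key := (((h1.pow 3).sub ((h1.const_mul 3).mul h2)).add (h3.const_mul 2)).div_const 6
  convert key using 1
  · funext N
    have h := six_mul_sum_range_sum_range_sum_range_mul
      (fun n : ℕ => (1 : ℝ) / (2 * (n : ℝ) + 1) ^ 2) N
    simp only [one_div_mul_one_div, one_div_pow, ← pow_mul, Nat.reduceMul] at h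
    linear_combination h / 6
  · norm_num [Nat.factorial]
    ring
end

section
/- The quadruple nested sum over quadruples of distinct odd positive integers satisfies ∑_{q=3}^{∞} ∑_{p=2}^{q-1} ∑_{m=1}^{p-1} ∑_{k=0}^{m-1} 1/((2k+1)²·(2m+1)²·(2p+1)²·(2q+1)²) = (1/8!)·(π/2)⁸, where k < m < p < q range over nonnegative integers. -/
open Real

section NewtonSums

variable {K : Type*} [Field K] [CharZero K] (b : ℕ → K) (n : ℕ)

theorem sum_range_two_nested :
    ∑ m ∈ Finset.range n, (∑ k ∈ Finset.range m, b k) * b m =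
      ((∑ k ∈ Finset.range n, b k) ^ 2 - ∑ k ∈ Finset.range n, b k ^ 2) / 2 := by
  induction n with
  | zero => simp
  | succ n ih => simp only [Finset.sum_range_succ _ n, ih]; ring

theorem sum_range_three_nested :
    ∑ p ∈ Finset.range n, (∑ m ∈ Finset.range p, (∑ k ∈ Finset.range m, b k) * b m) * b p =
      ((∑ k ∈ Finset.range n, b k) ^ 3
        - 3 * (∑ k ∈ Finset.range n, b k) * (∑ k ∈ Finset.range n, b k ^ 2)
        + 2 * ∑ k ∈ Finset.range n, b k ^ 3) / 6 := by
  induction n with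
  | zero => simp
  | succ n ih =>
    simp only [Finset.sum_range_succ _ n, ih, sum_range_two_nested b n]
    ring

theorem sum_range_four_nested :
    ∑ q ∈ Finset.range n, (∑ p ∈ Finset.range q,
        (∑ m ∈ Finset.range p, (∑ k ∈ Finset.range m, b k) * b m) * b p) * b q =
      ((∑ k ∈ Finset.range n, b k) ^ 4
        - 6 * (∑ k ∈ Finset.range n, b k) ^ 2 * (∑ k ∈ Finset.range n, b k ^ 2)
        + 3 * (∑ k ∈ Finset.range n, b k ^ 2) ^ 2
        + 8 * (∑ k ∈ Finset.range n, b k) * (∑ k ∈ Finset.range n, b k ^ 3)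
        - 6 * ∑ k ∈ Finset.range n, b k ^ 4) / 24 := by
  induction n with
  | zero => simp
  | succ n ih =>
    simp only [Finset.sum_range_succ _ n, ih, sum_range_three_nested b n]
    ring

end NewtonSums

theorem bernoulli_four : bernoulli 4 = -1 / 30 := by
  rw [bernoulli_eq_bernoulli'_of_ne_one (by norm_num), bernoulli'_four]

theorem bernoulli_six : bernoulli 6 = 1 / 42 := by
  rw [bernoulli_eq_bernoulli'_of_ne_one (by norm_num), bernoulli'_def]
  norm_num [Finset.sum_range_succ, bernoulli'_eq_zero_of_odd, show Odd 5 by decide,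
    Nat.choose]

theorem bernoulli_eight : bernoulli 8 = -1 / 30 := by
  have h6 : bernoulli' 6 = 1 / 42 := by
    rw [← bernoulli_eq_bernoulli'_of_ne_one (by norm_num), bernoulli_six]
  rw [bernoulli_eq_bernoulli'_of_ne_one (by norm_num), bernoulli'_def]
  norm_num [Finset.sum_range_succ, bernoulli'_eq_zero_of_odd, show Odd 5 by decide,
    show Odd 7 by decide, Nat.choose, h6]

theorem hasSum_one_div_odd_pow {j : ℕ} {S : ℝ}
    (hz : HasSum (fun n : ℕ ↦ 1 / (n : ℝ) ^ j) S) :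
    HasSum (fun n : ℕ ↦ 1 / (2 * (n : ℝ) + 1) ^ j) ((1 - 1 / 2 ^ j) * S) := by
  have heven : HasSum (fun n : ℕ ↦ 1 / ((2 * n : ℕ) : ℝ) ^ j) (1 / 2 ^ j * S) := by
    simpa [mul_pow, mul_comm] using hz.mul_left ((1 : ℝ) / 2 ^ j)
  have hodd : Summable (fun n : ℕ ↦ 1 / ((2 * n + 1 : ℕ) : ℝ) ^ j) :=
    hz.summable.comp_injective (i := fun n : ℕ ↦ 2 * n + 1) fun a b h ↦ by
      simpa using h
  have htotal : 1 / 2 ^ j * S + ∑' n : ℕ, 1 / ((2 * n + 1 : ℕ) : ℝ) ^ j = S :=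
    (HasSum.even_add_odd (f := fun n : ℕ ↦ 1 / (n : ℝ) ^ j) heven hodd.hasSum).unique hz
  have hsum := hodd.hasSum
  rw [show ∑' n : ℕ, 1 / ((2 * n + 1 : ℕ) : ℝ) ^ j = (1 - 1 / 2 ^ j) * S by linarith] at hsum
  simpa using hsum

theorem hasSum_one_div_odd_sq_pow {j : ℕ} (hj : j ≠ 0) :
    HasSum (fun n : ℕ ↦ (1 / (2 * (n : ℝ) + 1) ^ 2) ^ j)
      ((1 - 1 / 2 ^ (2 * j)) *
        ((-1) ^ (j + 1) * 2 ^ (2 * j - 1) * π ^ (2 * j) * bernoulli (2 * j) /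
          (2 * j).factorial)) := by
  simpa only [div_pow, one_pow, ← pow_mul] using hasSum_one_div_odd_pow (hasSum_zeta_nat hj)

theorem quadruple_nested_odd_reciprocal_squares_sum :
    (∑' q : ℕ, ∑ p ∈ Finset.range q, ∑ m ∈ Finset.range p, ∑ k ∈ Finset.range m,
      (1 : ℝ) / ((2 * (k : ℝ) + 1) ^ 2 * (2 * (m : ℝ) + 1) ^ 2 *
        (2 * (p : ℝ) + 1) ^ 2 * (2 * (q : ℝ) + 1) ^ 2))
      = (1 / (Nat.factorial 8)) * (π / 2) ^ 8 := by
  have h1 := (hasSum_one_div_odd_sq_pow one_ne_zero).tendsto_sum_nat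
  have h2 := (hasSum_one_div_odd_sq_pow two_ne_zero).tendsto_sum_nat
  have h3 := (hasSum_one_div_odd_sq_pow three_ne_zero).tendsto_sum_nat
  have h4 := (hasSum_one_div_odd_sq_pow four_ne_zero).tendsto_sum_nat
  simp only [pow_one] at h1
  refine HasSum.tsum_eq ?_
  rw [hasSum_iff_tendsto_nat_of_nonneg fun q ↦ by positivity]
  have hnewton := (((((h1.pow 4).sub (((h1.pow 2).const_mul 6).mul h2)).add
    ((h2.pow 2).const_mul 3)).add ((h1.const_mul 8).mul h3)).sub (h4.const_mul 6)).div_const 24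
  convert! hnewton using 1
  · ext n
    rw [← sum_range_four_nested]
    simp only [← one_div_mul_one_div, ← Finset.sum_mul]
  · norm_num [bernoulli_four, bernoulli_six, bernoulli_eight, Nat.factorial]
    ring
end

section
/- For every positive integer n, the sum over all n-element finite subsets s of the nonnegative integers of the product ∏_{i ∈ s} 1/(2i+1)² equals (1/(2n)!)·(π/2)^{2n}. -/
open Real

open Filter Topology

/-- Euler's product for the cosine, at the points where it follows from the duplication formula. -/
theorem tendsto_euler_cos_prod {x : ℝ} (hx : sin (π * (x / 2)) ≠ 0) :
    Tendsto (fun n : ℕ ↦ ∏ j ∈ Finset.range n, (1 - x ^ 2 / (2 * (j : ℝ) + 1) ^ 2))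
      atTop (𝓝 (cos (π / 2 * x))) := by
  have hx0 : x ≠ 0 := by rintro rfl; simp at hx
  have split (n : ℕ) : ∏ j ∈ Finset.range (2 * n), (1 - x ^ 2 / ((j : ℝ) + 1) ^ 2) =
      (∏ j ∈ Finset.range n, (1 - x ^ 2 / (2 * (j : ℝ) + 1) ^ 2)) *
        ∏ j ∈ Finset.range n, (1 - (x / 2) ^ 2 / ((j : ℝ) + 1) ^ 2) := by
    induction n with
    | zero => simp
    | succ k ih =>
      have h : x ^ 2 / ((2 * k + 1 : ℕ) + 1 : ℝ) ^ 2 = (x / 2) ^ 2 / ((k : ℝ) + 1) ^ 2 := by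
        push_cast
        field_simp
        ring
      rw [Nat.mul_succ, Finset.prod_range_succ, Finset.prod_range_succ, ih,
        Finset.prod_range_succ, Finset.prod_range_succ, h]
      push_cast
      ring
  have hsin := (Real.tendsto_euler_sin_prod x).comp
    (tendsto_id.const_mul_atTop' (show 0 < 2 by norm_num) : Tendsto (fun n : ℕ ↦ 2 * n) atTop atTop)
  have hhalf := Real.tendsto_euler_sin_prod (x / 2)
  have hquot := (hsin.div hhalf hx).div_const 2
  have hlim : sin (π * x) / sin (π * (x / 2)) / 2 = cos (π / 2 * x) := by
    rw [show π * x = 2 * (π * (x / 2)) by ring, sin_two_mul,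
      show π / 2 * x = π * (x / 2) by ring, mul_right_comm, mul_div_cancel_right₀ _ hx,
      mul_div_cancel_left₀ _ two_ne_zero]
  rw [hlim] at hquot
  refine hquot.congr' ?_
  filter_upwards [hhalf.eventually_ne hx] with n hn
  have hprod := right_ne_zero_of_mul hn
  simp only [Pi.div_apply, Function.comp_apply, split]
  generalize ∏ j ∈ Finset.range n, (1 - (x / 2) ^ 2 / ((j : ℝ) + 1) ^ 2) = p at hprod ⊢
  generalize ∏ j ∈ Finset.range n, (1 - x ^ 2 / (2 * (j : ℝ) + 1) ^ 2) = q
  field_simp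

theorem summable_one_div_odd_sq : Summable fun i : ℕ ↦ (1 : ℝ) / (2 * (i : ℝ) + 1) ^ 2 := by
  have h := (Real.summable_one_div_nat_pow.mpr one_lt_two).comp_injective
    (show Function.Injective fun i : ℕ ↦ 2 * i + 1 from fun a b h ↦ by grind)
  simpa [Function.comp_def] using h

/-- The generating function of the elementary symmetric sums of a summable family. -/
theorem hasSum_pow_mul_tsum_prod {ι : Type*} {a : ι → ℝ} (ha : Summable a) (t : ℝ) :
    HasSum (fun n : ℕ ↦ t ^ n * ∑' s : {s : Finset ι // s.card = n}, ∏ i ∈ (s : Finset ι), a i)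
      (∏' i, (1 + t * a i)) := by
  have hs : Summable fun s : Finset ι ↦ ∏ i ∈ s, t * a i :=
    summable_finsetProd_of_summable_norm (ha.mul_left t).norm
  rw [tprod_one_add hs]
  have h := ((Equiv.sigmaFiberEquiv (Finset.card : Finset ι → ℕ)).hasSum_iff.mpr hs.hasSum)
  have h' := h.sigma fun n ↦ (h.summable.sigma_factor n).hasSum
  refine h'.congr_fun ?_
  intro n
  rw [← tsum_mul_left]
  refine tsum_congr fun s ↦ ?_
  simp [Equiv.sigmaFiberEquiv, Finset.prod_mul_distrib, s.2]

theorem tprod_one_add_neg_sq_mul {x : ℝ} (hx : sin (π * (x / 2)) ≠ 0) :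
    ∏' i : ℕ, (1 + -x ^ 2 * (1 / (2 * (i : ℝ) + 1) ^ 2)) = cos (π / 2 * x) := by
  have hm : Multipliable fun i : ℕ ↦ (1 + -x ^ 2 * (1 / (2 * (i : ℝ) + 1) ^ 2)) :=
    multipliable_one_add_of_summable_prod <|
      summable_finsetProd_of_summable_norm (summable_one_div_odd_sq.mul_left _).norm
  refine tendsto_nhds_unique hm.hasProd.tendsto_prod_nat
    ((tendsto_euler_cos_prod hx).congr fun n ↦ Finset.prod_congr rfl fun i _ ↦ ?_)
  ring

theorem summable_pow_mul_div_factorial_two_mul (c t : ℝ) :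
    Summable fun n : ℕ ↦ t ^ n * (1 / (Nat.factorial (2 * n)) * c ^ (2 * n)) := by
  refine .of_norm ?_
  refine (Real.hasSum_cosh (c * √|t|)).summable.congr fun n ↦ ?_
  rw [mul_pow, pow_mul (√|t|), sq_sqrt (abs_nonneg t)]
  simp only [norm_mul, norm_pow, norm_div, norm_one, pow_mul, Real.norm_eq_abs,
    sq_abs, Nat.abs_cast]
  ring

/-- A real power series is determined by its sums at small negative arguments. -/
theorem eq_of_hasSum_pow_mul {a b : ℕ → ℝ} {f g : ℝ → ℝ}
    (hf : ∀ t, HasSum (fun n ↦ t ^ n * a n) (f t)) (hg : ∀ t, HasSum (fun n ↦ t ^ n * b n) (g t))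
    (hfg : ∀ᶠ t in 𝓝[<] 0, f t = g t) : a = b := by
  have key {a : ℕ → ℝ} {f : ℝ → ℝ} (hf : ∀ t, HasSum (fun n ↦ t ^ n * a n) (f t)) :
      HasFPowerSeriesAt f (FormalMultilinearSeries.ofScalars ℝ a) 0 := by
    rw [hasFPowerSeriesAt_iff]
    exact .of_forall fun t ↦ by simpa using hf t
  have hev : f =ᶠ[𝓝 0] g :=
    ((key hf).analyticAt.frequently_eq_iff_eventually_eq (key hg).analyticAt).mp <|
      hfg.frequently.filter_mono (nhdsWithin_mono _ fun _ h ↦ ne_of_lt h)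
  have h := (key hf).eq_formalMultilinearSeries_of_eventually (key hg) hev
  funext n
  simpa using congrArg (fun p : FormalMultilinearSeries ℝ ℝ ℝ ↦ p.coeff n) h

theorem nested_odd_reciprocal_squares_sum (n : ℕ) (hn : 0 < n) :
    (∑' s : {s : Finset ℕ // s.card = n},
      ∏ i ∈ (s : Finset ℕ), (1 : ℝ) / (2 * (i : ℝ) + 1) ^ 2)
      = (1 / (Nat.factorial (2 * n))) * (π / 2) ^ (2 * n) := by
  refine congrFun (eq_of_hasSum_pow_mul (hasSum_pow_mul_tsum_prod summable_one_div_odd_sq)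
    (fun t ↦ (summable_pow_mul_div_factorial_two_mul (π / 2) t).hasSum) ?_) n
  filter_upwards [Ioo_mem_nhdsLT (show (-1 : ℝ) < 0 by norm_num)] with t ht
  obtain ⟨x, hx0, hx1, rfl⟩ : ∃ x : ℝ, 0 < x ∧ x < 1 ∧ -x ^ 2 = t :=
    ⟨√(-t), sqrt_pos.mpr (by linarith [ht.2]), (sqrt_lt' one_pos).mpr (by linarith [ht.1]),
      by rw [sq_sqrt (by linarith [ht.2])]; ring⟩
  have hsin : sin (π * (x / 2)) ≠ 0 :=
    (sin_pos_of_pos_of_lt_pi (by positivity) (by nlinarith [pi_pos])).ne'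
  rw [tprod_one_add_neg_sq_mul hsin, Real.cos_eq_tsum]
  refine tsum_congr fun n ↦ ?_
  rw [neg_pow (x ^ 2), mul_pow, ← pow_mul]
  ring
end

section
/- For every real number x, the partial products ∏_{k=0}^{M-1} (1 − x²/(k + 1/2)²) converge, as M → ∞, to cos(π x); that is, cos(π x) has the infinite product representation cos(π x) = ∏_{k=1}^{∞} (1 − x²/(k − 1/2)²). -/
open Real Filter

/-- A term-by-term comparison of the partial products of the cosine product at `x` with those of
Euler's sine products at `x + 1 / 2` and at `1 / 2`. -/
lemma eulerSinProd_add_half (x : ℝ) (M : ℕ) :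
    (π * (x + 1 / 2) * ∏ j ∈ Finset.range M, (1 - (x + 1 / 2) ^ 2 / ((j : ℝ) + 1) ^ 2)) =
      (∏ k ∈ Finset.range M, (1 - x ^ 2 / ((k : ℝ) + 1 / 2) ^ 2)) *
        ((π * (1 / 2) * ∏ j ∈ Finset.range M, (1 - (1 / 2 : ℝ) ^ 2 / ((j : ℝ) + 1) ^ 2)) *
          (1 + 2 * x * (1 / (2 * (M : ℝ) + 1)))) := by
  induction M with
  | zero => simp; ring
  | succ M ih =>
    have key : (1 + 2 * x * (1 / (2 * (M : ℝ) + 1))) *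
        (1 - (x + 1 / 2) ^ 2 / ((M : ℝ) + 1) ^ 2) =
        (1 - x ^ 2 / ((M : ℝ) + 1 / 2) ^ 2) * ((1 - (1 / 2 : ℝ) ^ 2 / ((M : ℝ) + 1) ^ 2) *
          (1 + 2 * x * (1 / (2 * ((M + 1 : ℕ) : ℝ) + 1)))) := by
      have h₁ : (M : ℝ) + 1 / 2 ≠ 0 := by positivity
      have h₂ : 2 * ((M : ℝ) + 1) + 1 ≠ 0 := by positivity
      push_cast
      field_simp
      ring
    rw [Finset.prod_range_succ, Finset.prod_range_succ, Finset.prod_range_succ, ← mul_assoc, ih]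
    linear_combination (∏ k ∈ Finset.range M, (1 - x ^ 2 / ((k : ℝ) + 1 / 2) ^ 2)) *
      (π * (1 / 2) * ∏ j ∈ Finset.range M, (1 - (1 / 2 : ℝ) ^ 2 / ((j : ℝ) + 1) ^ 2)) * key

theorem cos_infinite_product (x : ℝ) :
    Filter.Tendsto (fun M : ℕ => ∏ k ∈ Finset.range M,
      (1 - x ^ 2 / ((k : ℝ) + 1 / 2) ^ 2)) atTop (nhds (Real.cos (π * x))) := by
  have hnum := Real.tendsto_euler_sin_prod (x + 1 / 2)
  rw [show sin (π * (x + 1 / 2)) = cos (π * x) by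
    rw [mul_add, mul_one_div, Real.sin_add_pi_div_two]] at hnum
  have hhalf := Real.tendsto_euler_sin_prod (1 / 2)
  rw [show sin (π * (1 / 2)) = 1 by rw [mul_one_div, Real.sin_pi_div_two]] at hhalf
  have hinv : Tendsto (fun M : ℕ => 1 / (2 * (M : ℝ) + 1)) atTop (nhds 0) := by
    simp_rw [one_div]
    exact tendsto_inv_atTop_zero.comp (tendsto_atTop_add_const_right _ _
      (tendsto_natCast_atTop_atTop.const_mul_atTop two_pos))
  have hden := hhalf.mul ((hinv.const_mul (2 * x)).const_add 1)
  simp only [mul_zero, add_zero, mul_one] at hden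
  have hquot := hnum.div hden one_ne_zero
  rw [div_one] at hquot
  refine hquot.congr' ?_
  filter_upwards [hden.eventually_ne one_ne_zero] with M hM
  rw [Pi.div_apply, eulerSinProd_add_half, mul_div_cancel_right₀ _ hM]
end
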